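/- Exchange law for programs: for all programs U, V, X, Y, (U ∥ V) ; (X ∥ Y) ⊆ (U ; X) ∥ (V ; Y). -/

import Mathlib

/-- A labelled set with a binary relation: a carrier of events, an ordering
relation and a labelling function into the alphabet `Γ`. -/
structure LPS (Γ : Type) : Type 1 where
  carrier : Type
  le : carrier → carrier → Prop
  label : carrier → Γ

namespace LPS

variable {Γ : Type}

/-- `p` is a partial string iff its relation is a partial order
(reflexive, transitive and antisymmetric). -/
def IsPartialString (p : LPS Γ) : Prop :=
  (∀ a, p.le a a) ∧
  (∀ a b c, p.le a b → p.le b c → p.le a c) ∧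
  (∀ a b, p.le a b → p.le b a → a = b)

/-- The order `≼_{x∥y}` on the coproduct `E_x + E_y`:
`(e,i) ≼ (e',j)` iff (`i = j = 0` and `e ≼_x e'`) or (`i = j = 1` and `e ≼_y e'`). -/
def parLe (x y : LPS Γ) : x.carrier ⊕ y.carrier → x.carrier ⊕ y.carrier → Prop
  | Sum.inl a, Sum.inl b => x.le a b
  | Sum.inr a, Sum.inr b => y.le a b
  | _, _ => False

/-- The order `≼_{x;y}` on the coproduct `E_x + E_y`:
`(e,i) ≼ (e',j)` iff `i < j` or `(e,i) ≼_{x∥y} (e',j)`. -/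
def seqLe (x y : LPS Γ) : x.carrier ⊕ y.carrier → x.carrier ⊕ y.carrier → Prop
  | Sum.inl a, Sum.inl b => x.le a b
  | Sum.inr a, Sum.inr b => y.le a b
  | Sum.inl _, Sum.inr _ => True
  | Sum.inr _, Sum.inl _ => False

/-- Concurrent composition `x ∥ y` on the coproduct `E_x + E_y`,
labels inherited componentwise. -/
def par (x y : LPS Γ) : LPS Γ :=
  ⟨x.carrier ⊕ y.carrier, parLe x y, Sum.elim x.label y.label⟩

/-- Strongly sequential composition `x ; y` on the coproduct `E_x + E_y`,
labels inherited componentwise. -/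
def seq (x y : LPS Γ) : LPS Γ :=
  ⟨x.carrier ⊕ y.carrier, seqLe x y, Sum.elim x.label y.label⟩

/-- `x ⊑ y`: there is a monotonic bijective morphism `f : y → x`, i.e. a
label-preserving monotonic bijection from the events of `y` to those of `x`. -/
def Refines (x y : LPS Γ) : Prop :=
  ∃ f : y.carrier → x.carrier, Function.Bijective f ∧
    (∀ a b, y.le a b → x.le (f a) (f b)) ∧
    (∀ a, y.label a = x.label (f a))

/-- `x ≅ y`: there is a label-preserving order-isomorphism from `x` to `y`. -/
def Iso (x y : LPS Γ) : Prop :=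
  ∃ f : x.carrier → y.carrier, Function.Bijective f ∧
    (∀ a b, x.le a b ↔ y.le (f a) (f b)) ∧
    (∀ a, x.label a = y.label (f a))

/-- The empty partial string `⊥` (no events). -/
def empty (Γ : Type) : LPS Γ :=
  ⟨PEmpty, fun _ _ => False, fun e => e.elim⟩

end LPS

/-- `P_f`: the collection of finite partial strings. -/
def Pf (Γ : Type) : Set (LPS Γ) := {p | p.IsPartialString ∧ Finite p.carrier}

/-- The downward closure `↓X := {y ∈ P_f | ∃ x ∈ X, y ⊑ x}`. -/
def dc {Γ : Type} (X : Set (LPS Γ)) : Set (LPS Γ) :=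
  {y | y ∈ Pf Γ ∧ ∃ x ∈ X, y.Refines x}

/-- A program is a downward-closed set of finite partial strings: `X = ↓X`. -/
def IsProgram {Γ : Type} (X : Set (LPS Γ)) : Prop := dc X = X

/-- Composition of programs: `X ⋈ Y := ↓{x ⋈ y | x ∈ X, y ∈ Y}`. -/
def pcomp {Γ : Type} (op : LPS Γ → LPS Γ → LPS Γ) (X Y : Set (LPS Γ)) :
    Set (LPS Γ) :=
  dc {z | ∃ x ∈ X, ∃ y ∈ Y, z = op x y}

namespace LPS

variable {Γ : Type}

theorem Refines.refl (x : LPS Γ) : x.Refines x :=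
  ⟨id, Function.bijective_id, fun _ _ h => h, fun _ => rfl⟩

theorem Refines.trans {x y z : LPS Γ} (hxy : x.Refines y) (hyz : y.Refines z) : x.Refines z := by
  obtain ⟨f, hf, hfm, hfl⟩ := hxy
  obtain ⟨g, hg, hgm, hgl⟩ := hyz
  exact ⟨f ∘ g, hf.comp hg, fun a b h => hfm _ _ (hgm _ _ h), fun a => (hgl a).trans (hfl _)⟩

theorem Refines.seq {x x' y y' : LPS Γ} (hx : x.Refines x') (hy : y.Refines y') :
    (x.seq y).Refines (x'.seq y') := by
  obtain ⟨f, hf, hfm, hfl⟩ := hx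
  obtain ⟨g, hg, hgm, hgl⟩ := hy
  refine ⟨Sum.map f g, Sum.map_bijective.2 ⟨hf, hg⟩, ?_, ?_⟩
  · rintro (a | a) (b | b) h
    · exact hfm a b h
    · trivial
    · exact h
    · exact hgm a b h
  · rintro (a | a)
    · exact hfl a
    · exact hgl a

/-- Exchange law for partial strings. -/
theorem seq_par_refines_par_seq (u v x y : LPS Γ) :
    ((u.par v).seq (x.par y)).Refines ((u.seq x).par (v.seq y)) := by
  refine ⟨Equiv.sumSumSumComm _ _ _ _, Equiv.bijective _, ?_, ?_⟩
  · rintro ((a | a) | (a | a)) ((b | b) | (b | b)) h <;> first | exact h | trivial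
  · rintro ((a | a) | (a | a)) <;> rfl

theorem IsPartialString.seq {x y : LPS Γ} (hx : x.IsPartialString) (hy : y.IsPartialString) :
    (x.seq y).IsPartialString := by
  obtain ⟨hxr, hxt, hxa⟩ := hx
  obtain ⟨hyr, hyt, hya⟩ := hy
  refine ⟨?_, ?_, ?_⟩
  · rintro (a | a)
    · exact hxr a
    · exact hyr a
  · rintro (a | a) (b | b) (c | c) h h' <;>
      first | exact hxt _ _ _ h h' | exact hyt _ _ _ h h' | trivial
  · rintro (a | a) (b | b) h h'
    · exact congrArg Sum.inl (hxa _ _ h h')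
    · exact h'.elim
    · exact h.elim
    · exact congrArg Sum.inr (hya _ _ h h')

end LPS

theorem seq_mem_Pf {Γ : Type} {x y : LPS Γ} (hx : x ∈ Pf Γ) (hy : y ∈ Pf Γ) :
    x.seq y ∈ Pf Γ := by
  have := hx.2
  have := hy.2
  exact ⟨hx.1.seq hy.1, inferInstanceAs (Finite (x.carrier ⊕ y.carrier))⟩

theorem IsProgram.subset_Pf {Γ : Type} {X : Set (LPS Γ)} (hX : IsProgram X) : X ⊆ Pf Γ :=
  fun _ hx => (hX.symm.subset hx).1

theorem seq_mem_pcomp {Γ : Type} {X Y : Set (LPS Γ)} (hX : IsProgram X) (hY : IsProgram Y)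
    {x y : LPS Γ} (hx : x ∈ X) (hy : y ∈ Y) : x.seq y ∈ pcomp LPS.seq X Y :=
  ⟨seq_mem_Pf (hX.subset_Pf hx) (hY.subset_Pf hy), _, ⟨x, hx, y, hy, rfl⟩, LPS.Refines.refl _⟩

/-- Exchange law for programs: for all programs `U, V, X, Y`,
`(U ∥ V) ; (X ∥ Y) ⊆ (U ; X) ∥ (V ; Y)`. -/
theorem program_exchange_law {Γ : Type} (U V X Y : Set (LPS Γ))
    (hU : IsProgram U) (hV : IsProgram V)
    (hX : IsProgram X) (hY : IsProgram Y) :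
    pcomp LPS.seq (pcomp LPS.par U V) (pcomp LPS.par X Y) ⊆
      pcomp LPS.par (pcomp LPS.seq U X) (pcomp LPS.seq V Y) := by
  rintro z ⟨hz, _, ⟨p, ⟨-, _, ⟨u, hu, v, hv, rfl⟩, hp⟩, q, ⟨-, _, ⟨x, hx, y, hy, rfl⟩, hq⟩, rfl⟩,
    hzpq⟩
  exact ⟨hz, _, ⟨_, seq_mem_pcomp hU hX hu hx, _, seq_mem_pcomp hV hY hv hy, rfl⟩,
    (hzpq.trans (hp.seq hq)).trans (LPS.seq_par_refines_par_seq u v x y)⟩
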